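/- Let G be a finite 3-subgroup of GL₃(ℂ) that cannot be generated by 3 elements. Then either G contains a subgroup isomorphic to (ℤ/3ℤ)³, or there exist a matrix P ∈ GL₃(ℂ) and complex roots of unity λ₁, λ₂, λ₃ whose orders are powers of 3 such that the conjugate group P⁻¹GP contains both the matrix σ with σ₁₂ = λ₂, σ₂₃ = λ₃, σ₃₁ = λ₁ and all other entries zero, and the matrix t = diag(1, ζ, ζ²), where ζ is a primitive cube root of unity. -/

import Mathlib

open Matrix

/-- A group `G` can be generated by at most `m` elements. -/
def GeneratedByAtMost (G : Type*) [Group G] (m : ℕ) : Prop :=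
  ∃ S : Finset G, S.card ≤ m ∧ Subgroup.closure (S : Set G) = ⊤

section Generators

variable {G : Type*} [Group G]

theorem GeneratedByAtMost.mono {m n : ℕ} (hmn : m ≤ n) (h : GeneratedByAtMost G m) :
    GeneratedByAtMost G n := by
  obtain ⟨S, hS, hcl⟩ := h
  exact ⟨S, hS.trans hmn, hcl⟩

theorem GeneratedByAtMost.of_mulEquiv {G' : Type*} [Group G'] {m : ℕ} (e : G ≃* G')
    (h : GeneratedByAtMost G m) : GeneratedByAtMost G' m := by
  classical
  obtain ⟨S, hS, hcl⟩ := h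
  refine ⟨S.image e, Finset.card_image_le.trans hS, ?_⟩
  have := e.toMonoidHom.map_closure (S : Set G)
  rw [hcl, Subgroup.map_top_of_surjective _ e.surjective] at this
  rw [Finset.coe_image]
  exact this.symm

/-- Adding one generator to those of a subgroup of prime index generates the whole group. -/
theorem GeneratedByAtMost.of_index_prime {m : ℕ} (A : Subgroup G) (hA : GeneratedByAtMost A m)
    (hidx : A.index = 1 ∨ A.index.Prime) : GeneratedByAtMost G (m + 1) := by
  classical
  obtain ⟨S, hS, hcl⟩ := hA
  have hcl' : Subgroup.closure ((S.image A.subtype : Finset G) : Set G) = A := by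
    rw [Finset.coe_image, ← MonoidHom.map_closure, hcl, ← MonoidHom.range_eq_map,
      Subgroup.range_subtype]
  have hcard : (S.image A.subtype).card ≤ m := Finset.card_image_le.trans hS
  by_cases htop : A = ⊤
  · exact ⟨_, hcard.trans m.le_succ, hcl'.trans htop⟩
  obtain ⟨g, hg⟩ : ∃ g, g ∉ A := by
    by_contra! hall
    exact htop (eq_top_iff.2 fun g _ => hall g)
  refine ⟨insert g (S.image A.subtype), (Finset.card_insert_le _ _).trans (by lia), ?_⟩
  set C := Subgroup.closure ((insert g (S.image A.subtype) : Finset G) : Set G)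
  have hAC : A ≤ C := by
    rw [← hcl']
    exact Subgroup.closure_mono (by simp)
  have hgC : g ∈ C := Subgroup.subset_closure (by simp)
  have hp : A.index.Prime := hidx.resolve_left fun h1 => htop (Subgroup.index_eq_one.1 h1)
  rcases (Nat.dvd_prime hp).1 (Subgroup.index_dvd_of_le hAC) with h1 | h1
  · exact Subgroup.index_eq_one.1 h1
  · have hrel := Subgroup.relIndex_mul_index hAC
    rw [h1] at hrel
    have : A.relIndex C = 1 := Nat.eq_of_mul_eq_mul_right hp.pos (by rw [hrel, one_mul])
    exact absurd (Subgroup.relIndex_eq_one.1 this hgC) hg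

theorem generatedByAtMost_pi_zmod {ι : Type*} [Fintype ι] (n : ι → ℕ) :
    GeneratedByAtMost ((i : ι) → Multiplicative (ZMod (n i))) (Fintype.card ι) := by
  classical
  refine ⟨Finset.univ.image fun i => Pi.mulSingle i (Multiplicative.ofAdd 1),
    Finset.card_image_le, eq_top_iff.2 fun x _ => Subgroup.pi_mem_of_mulSingle_mem x fun i => ?_⟩
  obtain ⟨k, hk⟩ := ZMod.intCast_surjective (x i).toAdd
  have hx : x i = Multiplicative.ofAdd (1 : ZMod (n i)) ^ k := by
    rw [← ofAdd_zsmul, zsmul_one, hk, ofAdd_toAdd]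
  rw [hx, Pi.mulSingle_zpow]
  exact Subgroup.zpow_mem _ (Subgroup.subset_closure (by simp)) _

/-- A finite abelian `p`-group is either generated by `r` elements or contains a copy of
`(ℤ/pℤ)^(r+1)`. -/
theorem IsPGroup.generatedByAtMost_or_exists_injective {p : ℕ} [hp : Fact p.Prime] {B : Type*}
    [CommGroup B] [Finite B] (hB : IsPGroup p B) (r : ℕ) :
    GeneratedByAtMost B r ∨
      ∃ f : (Fin (r + 1) → Multiplicative (ZMod p)) →* B, Function.Injective f := by
  obtain ⟨ι, _, n, hn, ⟨e⟩⟩ := CommGroup.equiv_prod_multiplicative_zmod_of_finite B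
  rcases le_or_gt (Fintype.card ι) r with hr | hr
  · exact Or.inl ((generatedByAtMost_pi_zmod n).of_mulEquiv e.symm |>.mono hr)
  right
  have hφ : ∀ i, ∃ φ : Multiplicative (ZMod p) →* Multiplicative (ZMod (n i)),
      Function.Injective φ := by
    classical
    intro i
    have : NeZero (n i) := NeZero.of_gt (hn i)
    have hPi : IsPGroup p (Multiplicative (ZMod (n i))) :=
      hB.of_injective (e.symm.toMonoidHom.comp
        (MonoidHom.mulSingle (fun i => Multiplicative (ZMod (n i))) i))
        (e.symm.injective.comp
          (Pi.mulSingle_injective (M := fun i => Multiplicative (ZMod (n i))) i))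
    obtain ⟨k, hk⟩ := IsPGroup.iff_card.1 hPi
    rw [Nat.card_eq_fintype_card, Fintype.card_multiplicative, ZMod.card] at hk
    have hdvd : p ∣ n i := by
      rw [hk]
      refine dvd_pow_self p ?_
      rintro rfl
      have := hn i
      simp_all
    obtain ⟨u, hu⟩ := exists_prime_orderOf_dvd_card' (G := Multiplicative (ZMod (n i))) p
      (by rwa [Nat.card_eq_fintype_card, Fintype.card_multiplicative, ZMod.card])
    have hc : Nat.card (Multiplicative (ZMod p)) = Nat.card (Subgroup.zpowers u) := by
      rw [Nat.card_zpowers, hu, Nat.card_eq_fintype_card, Fintype.card_multiplicative, ZMod.card]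
    exact ⟨(Subgroup.zpowers u).subtype.comp (mulEquivOfCyclicCardEq hc).toMonoidHom,
      Subtype.val_injective.comp (mulEquivOfCyclicCardEq hc).injective⟩
  choose φ hφ using hφ
  obtain ⟨j⟩ : Nonempty (Fin (r + 1) ↪ ι) :=
    Function.Embedding.nonempty_of_card_le (by simpa using hr)
  let F : (Fin (r + 1) → Multiplicative (ZMod p)) →* ((i : ι) → Multiplicative (ZMod (n i))) :=
    MonoidHom.pi fun i => (φ i).comp (Pi.evalMonoidHom _ (Function.invFun j i))
  refine ⟨e.symm.toMonoidHom.comp F, e.symm.injective.comp fun v w hvw => funext fun a => ?_⟩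
  have := hφ (j a) (congrFun hvw (j a))
  simpa [Function.leftInverse_invFun j.injective a] using this

end Generators

section Representation

open Module
open scoped commutatorElement

variable {K V : Type*} [Field K] [AddCommGroup V] [Module K V]

theorem Module.End.exists_hasEigenvalue_ne_one [IsAlgClosed K] [CharZero K] [FiniteDimensional K V]
    {z : End K V} {n : ℕ} (hn : n ≠ 0) (hz : z ^ n = 1) (hz1 : z ≠ 1) :
    ∃ c, z.HasEigenvalue c ∧ c ≠ 1 := by
  have hss : z.IsSemisimple := by
    refine End.isSemisimple_of_squarefree_aeval_eq_zero
      (Polynomial.separable_X_pow_sub_C (1 : K) (Nat.cast_ne_zero.2 hn) one_ne_zero).squarefree ?_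
    simp [hz]
  by_contra! hall
  have htop : z.eigenspace 1 = ⊤ := by
    rw [eq_top_iff, ← hss.iSup_eigenspace_eq_top]
    refine iSup_le fun c => ?_
    by_cases hc : z.HasEigenvalue c
    · rw [hall c hc]
    · rw [End.hasEigenvalue_iff, not_not] at hc
      simp [hc]
  refine hz1 (LinearMap.ext fun v => ?_)
  have hv : v ∈ z.eigenspace 1 := htop ▸ Submodule.mem_top
  simpa using End.mem_eigenspace_iff.1 hv

/-- If the commutator `z` of two automorphisms of a `p`-dimensional space commutes with both of
them, is nontrivial and has `p`-power order, then it is a scalar. -/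
theorem Module.End.exists_eq_smul_one_of_commutator [IsAlgClosed K] [CharZero K] {p : ℕ}
    [hp : Fact p.Prime] (hV : finrank K V = p) {z x g : End K V} {k : ℕ} (hz : z ^ p ^ k = 1)
    (hz1 : z ≠ 1) (hzx : Commute z x) (hzg : Commute z g) (hx : IsUnit x) (hg : IsUnit g)
    (h : g * x = z * (x * g)) : ∃ c : K, c ^ p = 1 ∧ c ≠ 1 ∧ z = c • (1 : End K V) := by
  have : FiniteDimensional K V := .of_finrank_pos (hV ▸ hp.out.pos)
  obtain ⟨c, hc, hc1⟩ := End.exists_hasEigenvalue_ne_one (pow_ne_zero k hp.out.ne_zero) hz hz1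
  set E := z.eigenspace c
  have hmem : ∀ {f : End K V}, Commute z f → ∀ v ∈ E, f v ∈ E := fun hf =>
    End.mapsTo_genEigenspace_of_comm hf c 1
  have hdet : ∀ {f : End K V} (hf : Commute z f), IsUnit f →
      LinearMap.det (f.restrict (hmem hf)) ≠ 0 := by
    intro f hf hu h0
    obtain ⟨v, hv, hv0⟩ := SetLike.exists_of_lt
      (bot_lt_iff_ne_bot.2 (LinearMap.bot_lt_ker_of_det_eq_zero h0).ne')
    have hv1 : f v = 0 := by simpa using congrArg Subtype.val (LinearMap.mem_ker.1 hv)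
    have hinj := ((End.isUnit_iff f).1 hu).1
    refine hv0 ?_
    have : (v : V) = 0 := hinj (by simpa using hv1)
    simpa using this
  have hrel : g.restrict (hmem hzg) * x.restrict (hmem hzx) =
      c • (x.restrict (hmem hzx) * g.restrict (hmem hzg)) := by
    ext v
    have h1 : g (x v) = z (x (g v)) := LinearMap.congr_fun h (v : V)
    have h2 := End.mem_eigenspace_iff.1 (hmem hzx _ (hmem hzg v v.2))
    simpa [h2] using h1
  have hcd : c ^ finrank K E = 1 := by
    have h1 := congrArg LinearMap.det hrel
    rw [LinearMap.det_smul, map_mul, map_mul, mul_comm] at h1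
    have h2 := mul_ne_zero (hdet hzx hx) (hdet hzg hg)
    exact (mul_right_cancel₀ h2 (by rw [one_mul]; exact h1)).symm
  have hcp : c ^ p ^ k = 1 := by
    obtain ⟨v, hv⟩ := hc.exists_hasEigenvector
    have h1 := hv.pow_apply (p ^ k)
    rw [hz, End.one_apply] at h1
    have h2 : (c ^ p ^ k - 1) • v = 0 := by rw [sub_smul, one_smul, ← h1, sub_self]
    exact sub_eq_zero.1 ((smul_eq_zero.1 h2).resolve_right hv.2)
  have hpE : p ∣ finrank K E := by
    obtain ⟨j, -, hj⟩ := (Nat.dvd_prime_pow hp.out).1 (orderOf_dvd_of_pow_eq_one hcp)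
    have hj0 : j ≠ 0 := by
      rintro rfl
      exact hc1 (orderOf_eq_one_iff.1 (by simpa using hj))
    exact (dvd_pow_self p hj0).trans (hj ▸ orderOf_dvd_of_pow_eq_one hcd)
  have hE0 : 0 < finrank K E := Module.finrank_pos_iff.2 (Submodule.nontrivial_iff_ne_bot.2 hc)
  have hEp : finrank K E = p :=
    le_antisymm (hV ▸ Submodule.finrank_le E) (Nat.le_of_dvd hE0 hpE)
  have hEtop : E = ⊤ := Submodule.eq_top_of_finrank_eq (hEp.trans hV.symm)
  refine ⟨c, by rwa [hEp] at hcd, hc1, LinearMap.ext fun v => ?_⟩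
  have hv : v ∈ E := hEtop ▸ Submodule.mem_top
  simpa using End.mem_eigenspace_iff.1 hv

/-- If `g` conjugates `x` to `c • x` with `c` a primitive `p`-th root of unity, `p` the dimension,
then `x` has distinct eigenvalues, so that its centralizer is commutative. -/
theorem Module.End.commute_of_commute_of_mul_eq_smul [IsAlgClosed K] {p : ℕ} [hp : Fact p.Prime]
    (hV : finrank K V = p) {x g : End K V} (hx : IsUnit x) (hg : IsUnit g) {c : K}
    (hcp : c ^ p = 1) (hc1 : c ≠ 1) (h : x * g = c • (g * x)) {a b : End K V}
    (ha : Commute a x) (hb : Commute b x) : Commute a b := by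
  have : FiniteDimensional K V := .of_finrank_pos (hV ▸ hp.out.pos)
  have : Nontrivial V := Module.nontrivial_of_finrank_pos (R := K) (hV ▸ hp.out.pos)
  have hc : IsPrimitiveRoot c p := .iff_orderOf.2 (orderOf_eq_prime hcp hc1)
  obtain ⟨μ, hμ⟩ := End.exists_eigenvalue x
  obtain ⟨v, hv⟩ := hμ.exists_hasEigenvector
  have hμ0 : μ ≠ 0 := by
    rintro rfl
    have hxv : x v = 0 := by simpa using hv.apply_eq_smul
    exact hv.2 (((End.isUnit_iff x).1 hx).1 (by simpa using hxv))
  have hvec : ∀ i : ℕ, x.HasEigenvector (c ^ i * μ) ((g ^ i) v) := by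
    intro i
    induction i with
    | zero => simpa using hv
    | succ i ih =>
      refine ⟨End.mem_eigenspace_iff.2 ?_, fun h0 => ?_⟩
      · have h1 := LinearMap.congr_fun h ((g ^ i) v)
        simp only [End.mul_apply, LinearMap.smul_apply, ih.apply_eq_smul, map_smul] at h1
        rw [pow_succ' g, End.mul_apply, h1, smul_smul, pow_succ']
        ring_nf
      · rw [pow_succ' g, End.mul_apply] at h0
        exact ih.2 (((End.isUnit_iff g).1 hg).1 (by simpa using h0))
  have hinj : Function.Injective fun i : Fin p => c ^ (i : ℕ) * μ := fun i j hij =>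
    Fin.ext (hc.pow_inj i.2 j.2 (mul_right_cancel₀ hμ0 hij))
  have hli := End.eigenvectors_linearIndependent' x _ hinj _ fun i : Fin p => hvec i
  have : Nonempty (Fin p) := ⟨⟨0, hp.out.pos⟩⟩
  let B := basisOfLinearIndependentOfCardEqFinrank hli (by simp [hV])
  have hB : ∀ i, x (B i) = (c ^ (i : ℕ) * μ) • B i := fun i => by
    simpa [B] using (hvec i).apply_eq_smul
  have hdiag : ∀ {a : End K V}, Commute a x → ∀ i, ∃ d : K, a (B i) = d • B i := by
    intro a ha i
    refine ⟨B.repr (a (B i)) i, ?_⟩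
    have hxrepr : ∀ w j, B.repr (x w) j = c ^ (j : ℕ) * μ * B.repr w j := by
      intro w j
      have : (Finsupp.lapply j ∘ₗ B.repr.toLinearMap) ∘ₗ x =
          (c ^ (j : ℕ) * μ) • (Finsupp.lapply j ∘ₗ B.repr.toLinearMap) := by
        refine B.ext fun i => ?_
        by_cases hij : i = j
        · subst hij
          simp [hB]
        · simp [hB, hij]
      exact LinearMap.congr_fun this w
    have hcomm : x (a (B i)) = (c ^ (i : ℕ) * μ) • a (B i) := by
      rw [← map_smul, ← hB]
      exact (LinearMap.congr_fun ha (B i)).symm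
    refine B.repr.injective (Finsupp.ext fun j => ?_)
    by_cases hij : i = j
    · subst hij
      simp
    have h1 := hxrepr (a (B i)) j
    rw [hcomm, map_smul, Finsupp.smul_apply, smul_eq_mul] at h1
    have h2 : B.repr (a (B i)) j = 0 := by
      by_contra h0
      exact hij (hinj (mul_right_cancel₀ h0 h1))
    simp [h2, hij]
  refine B.ext fun i => ?_
  obtain ⟨d, hd⟩ := hdiag ha i
  obtain ⟨d', hd'⟩ := hdiag hb i
  simp [hd, hd', smul_smul, mul_comm]

/-- A finite `p`-group with a faithful representation of dimension `p` has an abelian subgroup of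
index `1` or `p`. -/
theorem IsPGroup.exists_commutative_subgroup_index [IsAlgClosed K] [CharZero K] {p : ℕ}
    [hp : Fact p.Prime] (hV : finrank K V = p) {G : Type*} [Group G] [Finite G]
    (hG : IsPGroup p G) (ρ : G →* End K V) (hρ : Function.Injective ρ) :
    ∃ A : Subgroup G, IsMulCommutative A ∧ (A.index = 1 ∨ A.index.Prime) := by
  have : FiniteDimensional K V := .of_finrank_pos (hV ▸ hp.out.pos)
  by_cases hcomm : Subgroup.center G = ⊤
  · exact ⟨Subgroup.center G, inferInstance, Or.inl (Subgroup.index_eq_one.2 hcomm)⟩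
  obtain ⟨x, hx, hxc⟩ : ∃ x ∉ Subgroup.center G, ∀ g, ⁅g, x⁆ ∈ Subgroup.center G := by
    have : Nontrivial (G ⧸ Subgroup.center G) := QuotientGroup.nontrivial_iff.2 hcomm
    have := (hG.to_quotient (Subgroup.center G)).center_nontrivial
    obtain ⟨⟨y, hy⟩, hy1⟩ := exists_ne (1 : Subgroup.center (G ⧸ Subgroup.center G))
    obtain ⟨x, rfl⟩ := QuotientGroup.mk_surjective y
    refine ⟨x, fun hx => hy1 (Subtype.ext ((QuotientGroup.eq_one_iff x).2 hx)), fun g => ?_⟩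
    rw [← QuotientGroup.eq_one_iff, ← QuotientGroup.mk'_apply, map_commutatorElement,
      commutatorElement_eq_one_iff_mul_comm]
    exact Subgroup.mem_center_iff.1 hy g
  let τ : G →* G :=
    { toFun := fun g => ⁅g, x⁆
      map_one' := commutatorElement_one_left x
      map_mul' := fun g h => by
        have h1 := Subgroup.mem_center_iff.1 (hxc h) g
        have h2 : ⁅g * h, x⁆ = g * ⁅h, x⁆ * (x * g⁻¹ * x⁻¹) := by
          simp only [commutatorElement_def]
          group
        rw [h2, h1, mul_assoc, ← Subgroup.mem_center_iff.1 (hxc h)]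
        simp only [commutatorElement_def]
        group }
  have hker : ∀ g, g ∈ τ.ker ↔ Commute g x := fun g =>
    commutatorElement_eq_one_iff_mul_comm
  have hunit : ∀ g, IsUnit (ρ g) := fun g => (Group.isUnit g).map ρ
  have hscalar : ∀ g, ∃ c : K, c ^ p = 1 ∧ (τ g ≠ 1 → c ≠ 1) ∧ ρ (τ g) = c • (1 : End K V) := by
    intro g
    by_cases h1 : τ g = 1
    · exact ⟨1, one_pow p, fun h => absurd h1 h, by simp [h1]⟩
    have hz : ∀ y, Commute (τ g) y := fun y => (Subgroup.mem_center_iff.1 (hxc g) y).symm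
    obtain ⟨k, hk⟩ := hG (τ g)
    obtain ⟨c, hc, hc1, hzc⟩ := End.exists_eq_smul_one_of_commutator hV (z := ρ (τ g))
      (x := ρ x) (g := ρ g) (k := k) (by rw [← map_pow, hk, map_one])
      (fun h => h1 (hρ (h.trans ρ.map_one.symm))) ((hz x).map ρ) ((hz g).map ρ)
      (hunit x) (hunit g) (by
        rw [← map_mul, ← map_mul, ← map_mul]
        congr 1
        simp only [τ, MonoidHom.coe_mk, OneHom.coe_mk, commutatorElement_def]
        group)
    exact ⟨c, hc, fun _ => hc1, hzc⟩
  choose c hcp hc1 hc using hscalar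
  refine ⟨τ.ker, ⟨⟨?_⟩⟩, ?_⟩
  · obtain ⟨g, hg⟩ : ∃ g, τ g ≠ 1 := by
      by_contra! hall
      exact hx (Subgroup.mem_center_iff.2 fun g => (hker g).1 (hall g))
    have hrel : ρ g * ρ x = c g • (ρ x * ρ g) := by
      rw [← one_mul (ρ x * ρ g), ← smul_mul_assoc, ← hc g, ← map_mul, ← map_mul, ← map_mul]
      congr 1
      simp only [τ, MonoidHom.coe_mk, OneHom.coe_mk, commutatorElement_def]
      group
    have hc0 : c g ≠ 0 := fun h0 => by
      have := hcp g
      rw [h0, zero_pow hp.out.ne_zero] at this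
      exact zero_ne_one this
    have hrel' : ρ x * ρ g = (c g)⁻¹ • (ρ g * ρ x) := by
      rw [hrel, smul_smul, inv_mul_cancel₀ hc0, one_smul]
    rintro ⟨a, ha⟩ ⟨b, hb⟩
    refine Subtype.ext (hρ ?_)
    simpa using! (End.commute_of_commute_of_mul_eq_smul hV (hunit x) (hunit g)
      (by rw [inv_pow, hcp, inv_one]) (by simpa using hc1 g hg) hrel'
      (((hker a).1 ha).map ρ) (((hker b).1 hb).map ρ)).eq
  · have hle : τ.ker.index ≤ p := by
      classical
      have hsub : Set.range τ ⊆ ρ ⁻¹' ((fun d : K => d • (1 : End K V)) ''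
          (Polynomial.nthRootsFinset p (1 : K) : Set K)) := by
        rintro _ ⟨g, rfl⟩
        exact ⟨c g, by simp [Polynomial.mem_nthRootsFinset hp.out.pos, hcp], (hc g).symm⟩
      rw [Subgroup.index_ker]
      calc Nat.card τ.range = (Set.range τ).ncard := by
            rw [← MonoidHom.coe_range, ← Nat.card_coe_set_eq]; rfl
        _ ≤ ((fun d : K => d • (1 : End K V)) ''
              (Polynomial.nthRootsFinset p (1 : K) : Set K)).ncard :=
            Set.ncard_le_ncard_of_injOn ρ (fun _ h => hsub h) hρ.injOn
              ((Finset.finite_toSet _).image _)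
        _ ≤ (Polynomial.nthRootsFinset p (1 : K) : Set K).ncard :=
            Set.ncard_image_le (Finset.finite_toSet _)
        _ ≤ p := by
            rw [Set.ncard_coe_finset, Polynomial.nthRootsFinset_def]
            exact (Multiset.toFinset_card_le _).trans (Polynomial.card_nthRoots p 1)
    obtain ⟨k, hk⟩ := hG.index τ.ker
    rcases k with _ | _ | k
    · exact Or.inl (by simpa using hk)
    · exact Or.inr (by simpa [hk] using hp.out)
    · have : p ^ 2 ≤ p ^ (k + 2) := Nat.pow_le_pow_right hp.out.pos (by lia)
      have := hp.out.two_le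
      nlinarith

end Representation

theorem stmt_8 (G : Subgroup (GL (Fin 3) ℂ)) [Finite G] (hG : IsPGroup 3 G)
    (h : ¬ GeneratedByAtMost G 3) :
    (∃ H : Subgroup (GL (Fin 3) ℂ), H ≤ G ∧
      Nonempty (H ≃* Multiplicative (ZMod 3) × Multiplicative (ZMod 3) ×
        Multiplicative (ZMod 3))) ∨
    (∃ (P : GL (Fin 3) ℂ) (lam : Fin 3 → ℂ) (k : Fin 3 → ℕ) (ζ : ℂ),
      (∀ i, lam i ^ (3 ^ k i) = 1) ∧ ζ ^ 3 = 1 ∧ ζ ≠ 1 ∧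
      ∃ σ t : GL (Fin 3) ℂ,
        ((σ : GL (Fin 3) ℂ) : Matrix (Fin 3) (Fin 3) ℂ) =
          Matrix.of ![![0, lam 1, 0], ![0, 0, lam 2], ![lam 0, 0, 0]] ∧
        ((t : GL (Fin 3) ℂ) : Matrix (Fin 3) (Fin 3) ℂ) =
          Matrix.diagonal ![1, ζ, ζ ^ 2] ∧
        P * σ * P⁻¹ ∈ G ∧ P * t * P⁻¹ ∈ G) := by
  have : Fact (Nat.Prime 3) := ⟨Nat.prime_three⟩
  let ρ : G →* Module.End ℂ (Fin 3 → ℂ) :=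
    ((Matrix.toLinAlgEquiv' (R := ℂ) (n := Fin 3)).toMonoidHom.comp
      (Units.coeHom (Matrix (Fin 3) (Fin 3) ℂ))).comp G.subtype
  have hρ : Function.Injective ρ :=
    (Matrix.toLinAlgEquiv'.injective.comp Units.val_injective).comp Subtype.val_injective
  obtain ⟨A, hA, hidx⟩ := hG.exists_commutative_subgroup_index (by simp) ρ hρ
  let _ : CommGroup A := { mul_comm := hA.is_comm.comm }
  rcases (hG.to_subgroup A).generatedByAtMost_or_exists_injective 2 with hgen | ⟨f, hf⟩
  · exact absurd (hgen.of_index_prime A hidx) h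
  left
  let M := Multiplicative (ZMod 3)
  let t : M × M × M →* (Fin 3 → M) :=
    { toFun := fun v => ![v.1, v.2.1, v.2.2]
      map_one' := by ext i; fin_cases i <;> rfl
      map_mul' := fun v w => by ext i; fin_cases i <;> rfl }
  have ht : Function.Injective t := fun v w hvw =>
    Prod.ext (congrFun hvw 0) (Prod.ext (congrFun hvw 1) (congrFun hvw 2))
  let F : M × M × M →* GL (Fin 3) ℂ := G.subtype.comp (A.subtype.comp (f.comp t))
  have hF : Function.Injective F :=
    Subtype.val_injective.comp (Subtype.val_injective.comp (hf.comp ht))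
  refine ⟨F.range, ?_, ⟨(MonoidHom.ofInjective hF).symm⟩⟩
  rintro _ ⟨v, rfl⟩
  exact (A.subtype (f (t v))).2
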